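/- arXiv:1708.04832 — 2 statements merged into one kernel-verified Lean document; each statement's English description precedes it below -/
import Mathlib

section
/- Let Λ and Υ be nonempty countable sets, λ : Λ → Λ and μ : Υ → Υ arbitrary maps, and consider the product dynamical system σ_λ × σ_μ : X^Λ × X^Υ → X^Λ × X^Υ, (x,y) ↦ (σ_λ(x), σ_μ(y)), on the compact metrizable space X^Λ × X^Υ. Then: (1) (X^Λ × X^Υ, σ_λ × σ_μ) is dense distributional chaotic if and only if both (X^Λ, σ_λ) and (X^Υ, σ_μ) are dense distributional chaotic; (2) (X^Λ × X^Υ, σ_λ × σ_μ) is transitive distributional chaotic if and only if both (X^Λ, σ_λ) and (X^Υ, σ_μ) are transitive distributional chaotic (each property taken with respect to any compatible metric). -/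
open Filter Topology

/-- `d : Y → Y → ℝ` is a metric on the topological space `Y` compatible with
(i.e. inducing) its topology. -/
def IsCompatibleMetric (Y : Type*) [t : TopologicalSpace Y] (d : Y → Y → ℝ) : Prop :=
  ∃ m : MetricSpace Y, m.toUniformSpace.toTopologicalSpace = t ∧ ∀ a b, m.dist a b = d a b

/-- The generalized shift `σ_φ : X^Γ → X^Γ`, `σ_φ((x_α)_α) = (x_{φ(α)})_α`. -/
def genShift {X Γ : Type*} (φ : Γ → Γ) (x : Γ → X) : Γ → X := fun α => x (φ α)

/-- `θ` is a quasi-periodic point of `φ` iff its forward orbit `{φ^n(θ) : n ≥ 0}` is finite. -/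
def QuasiPeriodic {Γ : Type*} (φ : Γ → Γ) (θ : Γ) : Prop :=
  (Set.range fun n : ℕ => φ^[n] θ).Finite

/-- `θ` is a periodic point of `φ` iff `φ^n(θ) = θ` for some `n ≥ 1`. -/
def PeriodicPt {Γ : Type*} (φ : Γ → Γ) (θ : Γ) : Prop := ∃ n ≥ 1, φ^[n] θ = θ

/-- `ξ(x,y,t,n) = #{i ∈ {0,…,n−1} : d(f^i(x), f^i(y)) < t}`. -/
noncomputable def xiCount {Y : Type*} (d : Y → Y → ℝ) (f : Y → Y) (x y : Y) (t : ℝ) (n : ℕ) :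
    ℕ :=
  {i : ℕ | i < n ∧ d (f^[i] x) (f^[i] y) < t}.ncard

/-- `F_{xy}(t) = liminf_n ξ(x,y,t,n)/n`. -/
noncomputable def Fdist {Y : Type*} (d : Y → Y → ℝ) (f : Y → Y) (x y : Y) (t : ℝ) : ℝ :=
  liminf (fun n : ℕ => (xiCount d f x y t n : ℝ) / n) atTop

/-- `F*_{xy}(t) = limsup_n ξ(x,y,t,n)/n`. -/
noncomputable def FdistStar {Y : Type*} (d : Y → Y → ℝ) (f : Y → Y) (x y : Y) (t : ℝ) : ℝ :=
  limsup (fun n : ℕ => (xiCount d f x y t n : ℝ) / n) atTop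

/-- `ζ(x,y,γ_D,n) = #{i ∈ {0,…,n−1} : (f^i(x), f^i(y)) ∈ γ_D}` where
`γ_D = {(u,v) : u_α = v_α for all α ∈ D}`. -/
noncomputable def zetaCount {X Γ : Type*} (f : (Γ → X) → (Γ → X)) (x y : Γ → X) (D : Set Γ)
    (n : ℕ) : ℕ :=
  {i : ℕ | i < n ∧ ∀ α ∈ D, f^[i] x α = f^[i] y α}.ncard

/-- `G_{xy}(γ_D) = liminf_n ζ(x,y,γ_D,n)/n`. -/
noncomputable def Gdist {X Γ : Type*} (f : (Γ → X) → (Γ → X)) (x y : Γ → X) (D : Set Γ) : ℝ :=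
  liminf (fun n : ℕ => (zetaCount f x y D n : ℝ) / n) atTop

/-- `G*_{xy}(γ_D) = limsup_n ζ(x,y,γ_D,n)/n`. -/
noncomputable def GdistStar {X Γ : Type*} (f : (Γ → X) → (Γ → X)) (x y : Γ → X) (D : Set Γ) :
    ℝ :=
  limsup (fun n : ℕ => (zetaCount f x y D n : ℝ) / n) atTop

/-- `x, y` are distributionally scrambled of type 1 (w.r.t. the metric `d` and the map `f`). -/
def DistScrambled1 {Y : Type*} (d : Y → Y → ℝ) (f : Y → Y) (x y : Y) : Prop :=
  (∃ s > 0, Fdist d f x y s = 0) ∧ ∀ s > 0, FdistStar d f x y s = 1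

/-- `x, y` are distributionally scrambled of type 2. -/
def DistScrambled2 {Y : Type*} (d : Y → Y → ℝ) (f : Y → Y) (x y : Y) : Prop :=
  (∃ s > 0, Fdist d f x y s < 1) ∧ ∀ s > 0, FdistStar d f x y s = 1

/-- `x, y` are distributionally scrambled of type 3. -/
def DistScrambled3 {Y : Type*} (d : Y → Y → ℝ) (f : Y → Y) (x y : Y) : Prop :=
  ∃ a b : ℝ, 0 < a ∧ a < b ∧ ∀ s ∈ Set.Icc a b, Fdist d f x y s < FdistStar d f x y s

/-- `A` is a distributionally scrambled set of type 1: it has at least two elements and all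
pairs of distinct points of `A` are distributionally scrambled of type 1. -/
def DistScrambledSet1 {Y : Type*} (d : Y → Y → ℝ) (f : Y → Y) (A : Set Y) : Prop :=
  A.Nontrivial ∧ ∀ x ∈ A, ∀ y ∈ A, x ≠ y → DistScrambled1 d f x y

/-- `A` is a distributionally scrambled set of type 2. -/
def DistScrambledSet2 {Y : Type*} (d : Y → Y → ℝ) (f : Y → Y) (A : Set Y) : Prop :=
  A.Nontrivial ∧ ∀ x ∈ A, ∀ y ∈ A, x ≠ y → DistScrambled2 d f x y

/-- `A` is a distributionally scrambled set of type 3. -/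
def DistScrambledSet3 {Y : Type*} (d : Y → Y → ℝ) (f : Y → Y) (A : Set Y) : Prop :=
  A.Nontrivial ∧ ∀ x ∈ A, ∀ y ∈ A, x ≠ y → DistScrambled3 d f x y

/-- `(Y,f)` is uniform distributionally chaotic: there is an uncountable distributionally
scrambled set `A` of type 1 and a single `ε > 0` with `F_{xy}(ε) = 0` for distinct `x,y ∈ A`. -/
def UniformDC {Y : Type*} (d : Y → Y → ℝ) (f : Y → Y) : Prop :=
  ∃ A : Set Y, ¬ A.Countable ∧ DistScrambledSet1 d f A ∧
    ∃ ε > 0, ∀ x ∈ A, ∀ y ∈ A, x ≠ y → Fdist d f x y ε = 0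

/-- `a` is a transitive point of `f`: its forward orbit is dense. -/
def TransitivePoint {Y : Type*} [TopologicalSpace Y] (f : Y → Y) (a : Y) : Prop :=
  Dense (Set.range fun n : ℕ => f^[n] a)

/-- `(Y,f)` is dense distributionally chaotic: uniform distributional chaos witnessed by a
dense set. -/
def DenseDC {Y : Type*} [TopologicalSpace Y] (d : Y → Y → ℝ) (f : Y → Y) : Prop :=
  ∃ A : Set Y, ¬ A.Countable ∧ Dense A ∧ DistScrambledSet1 d f A ∧
    ∃ ε > 0, ∀ x ∈ A, ∀ y ∈ A, x ≠ y → Fdist d f x y ε = 0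

/-- `(Y,f)` is transitive distributionally chaotic: uniform distributional chaos witnessed by a
dense set of transitive points. -/
def TransitiveDC {Y : Type*} [TopologicalSpace Y] (d : Y → Y → ℝ) (f : Y → Y) : Prop :=
  ∃ A : Set Y, ¬ A.Countable ∧ Dense A ∧ (∀ a ∈ A, TransitivePoint f a) ∧
    DistScrambledSet1 d f A ∧
    ∃ ε > 0, ∀ x ∈ A, ∀ y ∈ A, x ≠ y → Fdist d f x y ε = 0

/-- The ω-limit set of `a` under `f`: all limits of `f^[n k] a` along strictly increasing
sequences `n`. -/
def OmegaSet {Y : Type*} [TopologicalSpace Y] (f : Y → Y) (a : Y) : Set Y :=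
  {z | ∃ n : ℕ → ℕ, StrictMono n ∧ Tendsto (fun k => f^[n k] a) atTop (nhds z)}

/-- The set of periodic points of `f`. -/
def PerSet {Y : Type*} (f : Y → Y) : Set Y := {y | ∃ n ≥ 1, f^[n] y = y}

/-- `x, y` are `ω^u`-scrambled. -/
def OmegaUScrambled {Y : Type*} [TopologicalSpace Y] (f : Y → Y) (x y : Y) : Prop :=
  ¬ (OmegaSet f x \ OmegaSet f y).Countable ∧
    (OmegaSet f x ∩ OmegaSet f y).Nonempty ∧ (OmegaSet f x \ PerSet f).Nonempty

/-- `x, y` are `ω^∞`-scrambled. -/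
def OmegaInfScrambled {Y : Type*} [TopologicalSpace Y] (f : Y → Y) (x y : Y) : Prop :=
  (OmegaSet f x \ OmegaSet f y).Infinite ∧
    (OmegaSet f x ∩ OmegaSet f y).Nonempty ∧ (OmegaSet f x \ PerSet f).Nonempty

/-- `A` is an `ω^u`-scrambled set. -/
def OmegaUScrambledSet {Y : Type*} [TopologicalSpace Y] (f : Y → Y) (A : Set Y) : Prop :=
  A.Nontrivial ∧ ∀ x ∈ A, ∀ y ∈ A, x ≠ y → OmegaUScrambled f x y

/-- `A` is an `ω^∞`-scrambled set. -/
def OmegaInfScrambledSet {Y : Type*} [TopologicalSpace Y] (f : Y → Y) (A : Set Y) : Prop :=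
  A.Nontrivial ∧ ∀ x ∈ A, ∀ y ∈ A, x ≠ y → OmegaInfScrambled f x y

variable {X : Type*} [Fintype X] [TopologicalSpace X] [DiscreteTopology X] [Nontrivial X]
variable {Γ : Type*} [Countable Γ] [Nonempty Γ]

section Residual

/-- In a nonempty second countable Baire space, if every section of a symmetric irreflexive
relation is residual, then any residual set contains an uncountable dense set all of whose
distinct points are related. -/
theorem exists_uncountable_dense_pairwise {Z : Type*} [TopologicalSpace Z] [BaireSpace Z]
    [SecondCountableTopology Z] [Nonempty Z] {R : Z → Z → Prop} {T : Set Z}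
    (hsymm : ∀ x y, R x y → R y x) (hirr : ∀ x, ¬ R x x)
    (hR : ∀ y, ∀ᶠ x in residual Z, R x y) (hT : T ∈ residual Z) :
    ∃ A : Set Z, ¬ A.Countable ∧ Dense A ∧ A ⊆ T ∧ ∀ x ∈ A, ∀ y ∈ A, x ≠ y → R x y := by
  classical
  obtain ⟨B, hBc, hBe, hB⟩ := TopologicalSpace.exists_countable_basis Z
  have hBne : Nonempty B := by
    obtain ⟨U, hU, -⟩ := hB.exists_subset_of_mem_open
      (Set.mem_univ (Classical.arbitrary Z)) isOpen_univ
    exact ⟨⟨U, hU⟩⟩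
  have : Countable B := hBc
  let I : Type := (Cardinal.aleph 1).ord.ToType
  have hIcard : Cardinal.mk I = Cardinal.aleph 1 := Cardinal.mk_ord_toType _
  have hIio : ∀ i : I, (Set.Iio i).Countable := fun i => by
    rw [← Cardinal.le_aleph0_iff_set_countable, ← Cardinal.lt_aleph_one_iff]
    exact (Cardinal.mk_Iio_lt i (by simp [I])).trans_eq hIcard
  have hIunc : ¬ (Set.univ : Set I).Countable := by
    rw [← Cardinal.le_aleph0_iff_set_countable, ← Cardinal.lt_aleph_one_iff, Cardinal.mk_univ,
      hIcard]
    exact lt_irrefl _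
  have hIinf : Infinite I := by
    by_contra h
    rw [not_infinite_iff_finite] at h
    exact hIunc (Set.toFinite _).countable
  obtain ⟨g, hg⟩ : ∃ g : I → B, Function.Surjective g := by
    obtain ⟨k, hk⟩ := exists_surjective_nat B
    refine ⟨k ∘ Function.invFun (Infinite.natEmbedding I), hk.comp ?_⟩
    exact Function.invFun_surjective (Infinite.natEmbedding I).injective
  have step : ∀ (i : I) (F : (j : I) → j < i → Z),
      ∃ x, x ∈ (g i : Set Z) ∧ x ∈ T ∧ ∀ j hj, R x (F j hj) := by
    intro i F
    have h1 : ∀ᶠ x in residual Z, x ∈ T ∧ ∀ j : Set.Iio i, R x (F j j.2) := by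
      have : Countable (Set.Iio i) := hIio i
      exact Filter.Eventually.and hT (eventually_countable_forall.2 fun j => hR _)
    have hne : (g i : Set Z).Nonempty :=
      Set.nonempty_iff_ne_empty.2 fun h => hBe (h ▸ (g i).2)
    obtain ⟨x, hx, hxU⟩ := (dense_of_mem_residual h1).inter_open_nonempty _
      (hB.isOpen (g i).2) hne
    exact ⟨x, hx, hxU.1, fun j hj => hxU.2 ⟨j, hj⟩⟩
  choose c hc using step
  let f : I → Z := fun i => (wellFounded_lt (α := I)).fix c i
  have hf : ∀ i, f i = c i (fun j _ => f j) := fun i => WellFounded.fix_eq _ _ _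
  have hfU : ∀ i, f i ∈ (g i : Set Z) := fun i => by rw [hf]; exact (hc _ _).1
  have hfT : ∀ i, f i ∈ T := fun i => by rw [hf]; exact (hc _ _).2.1
  have hfR : ∀ i j, j < i → R (f i) (f j) := fun i j hj => by
    rw [hf i]; exact (hc i _).2.2 j hj
  have hfR' : ∀ i j, i ≠ j → R (f i) (f j) := fun i j hij => by
    rcases lt_or_gt_of_ne hij with h | h
    · exact hsymm _ _ (hfR _ _ h)
    · exact hfR _ _ h
  have hinj : Function.Injective f := fun i j hij => by
    by_contra h
    have := hfR' i j h
    rw [hij] at this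
    exact hirr _ this
  refine ⟨Set.range f, ?_, ?_, ?_, ?_⟩
  · rw [← Set.image_univ]
    exact fun h => hIunc (Set.countable_of_injective_of_countable_image hinj.injOn h)
  · rw [hB.dense_iff]
    intro U hU _
    obtain ⟨i, hi⟩ := hg ⟨U, hU⟩
    refine ⟨f i, ?_, i, rfl⟩
    have := hfU i
    rwa [hi] at this
  · rintro _ ⟨i, rfl⟩
    exact hfT i
  · rintro _ ⟨i, rfl⟩ _ ⟨j, rfl⟩ hij
    exact hfR' i j fun h => hij (h ▸ rfl)

end Residual

section Density

theorem countLT_le (P : ℕ → Prop) (n : ℕ) : {i | i < n ∧ P i}.ncard ≤ n := by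
  calc {i | i < n ∧ P i}.ncard ≤ (Set.Iio n).ncard :=
        Set.ncard_le_ncard (fun i hi => hi.1) (Set.finite_Iio n)
    _ = n := by simp

theorem countLT_div_le_one (P : ℕ → Prop) (n : ℕ) :
    ({i | i < n ∧ P i}.ncard : ℝ) / n ≤ 1 :=
  div_le_one_of_le₀ (by exact_mod_cast countLT_le P n) (by positivity)

theorem isBoundedUnder_le_countLT (P : ℕ → Prop) :
    IsBoundedUnder (· ≤ ·) atTop fun n : ℕ => ({i | i < n ∧ P i}.ncard : ℝ) / n :=
  isBoundedUnder_of ⟨1, countLT_div_le_one P⟩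

theorem isBoundedUnder_ge_countLT (P : ℕ → Prop) :
    IsBoundedUnder (· ≥ ·) atTop fun n : ℕ => ({i | i < n ∧ P i}.ncard : ℝ) / n :=
  isBoundedUnder_of ⟨0, fun n => by positivity⟩

/-- A property holding on long windows `[n, m * n)` has upper density one. -/
theorem limsup_countLT_eq_one {P : ℕ → Prop}
    (h : ∀ m, ∃ n ≥ m, ∀ i, n ≤ i → i < m * n → P i) :
    limsup (fun n : ℕ => ({i | i < n ∧ P i}.ncard : ℝ) / n) atTop = 1 := by
  apply le_antisymm
  · exact limsup_le_of_le (isBoundedUnder_ge_countLT P).isCoboundedUnder_le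
      (Eventually.of_forall (countLT_div_le_one P))
  · refine le_of_forall_lt fun a ha => ?_
    obtain ⟨k, hk⟩ := exists_nat_one_div_lt (sub_pos.2 ha)
    refine lt_of_lt_of_le (b := 1 - 1 / ((k : ℝ) + 1)) (by linarith) ?_
    refine le_limsup_of_frequently_le ?_ (isBoundedUnder_le_countLT P)
    rw [frequently_atTop]
    intro N
    obtain ⟨n, hn, hP⟩ := h (N + k + 1)
    have hn0 : 0 < n := by omega
    refine ⟨(N + k + 1) * n, by nlinarith, ?_⟩
    have hcard : (N + k) * n ≤ {i | i < (N + k + 1) * n ∧ P i}.ncard := by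
      calc (N + k) * n = (Set.Ico n ((N + k + 1) * n)).ncard := by
            rw [← Finset.coe_Ico, Set.ncard_coe_finset, Nat.card_Ico, Nat.add_mul _ 1,
              one_mul, Nat.add_sub_cancel]
        _ ≤ {i | i < (N + k + 1) * n ∧ P i}.ncard :=
          Set.ncard_le_ncard (fun i hi => ⟨hi.2, hP i hi.1 hi.2⟩)
            ((Set.finite_Iio _).subset fun i hi => hi.1)
    have hcard' : ((N : ℝ) + k) * n ≤ ({i | i < (N + k + 1) * n ∧ P i}.ncard : ℝ) := by
      exact_mod_cast hcard
    have hn0' : (0 : ℝ) < n := by exact_mod_cast hn0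
    rw [le_div_iff₀ (by positivity)]
    refine le_trans ?_ hcard'
    push_cast
    have hfrac : 1 ≤ 1 / ((k : ℝ) + 1) * (N + k + 1) := by
      rw [one_div, inv_mul_eq_div, le_div_iff₀ (by positivity)]
      have : (0 : ℝ) ≤ N := by positivity
      linarith
    nlinarith

/-- A property failing on long windows `[n, m * n)` has lower density zero. -/
theorem liminf_countLT_eq_zero {P : ℕ → Prop}
    (h : ∀ m, ∃ n ≥ m, ∀ i, n ≤ i → i < m * n → ¬ P i) :
    liminf (fun n : ℕ => ({i | i < n ∧ P i}.ncard : ℝ) / n) atTop = 0 := by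
  apply le_antisymm
  · refine le_of_forall_gt fun a ha => ?_
    obtain ⟨k, hk⟩ := exists_nat_one_div_lt ha
    refine lt_of_le_of_lt ?_ hk
    refine liminf_le_of_frequently_le ?_ (isBoundedUnder_ge_countLT P)
    rw [frequently_atTop]
    intro N
    obtain ⟨n, hn, hP⟩ := h (N + k + 1)
    have hn0 : 0 < n := by omega
    refine ⟨(N + k + 1) * n, by nlinarith, ?_⟩
    have hcard : {i | i < (N + k + 1) * n ∧ P i}.ncard ≤ n := by
      calc _ ≤ (Set.Iio n).ncard := Set.ncard_le_ncard
            (fun i hi => lt_of_not_ge fun hni => hP i hni hi.1 hi.2) (Set.finite_Iio n)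
        _ = n := by simp
    have hcard' : ({i | i < (N + k + 1) * n ∧ P i}.ncard : ℝ) ≤ n := by exact_mod_cast hcard
    have hn0' : (0 : ℝ) < n := by exact_mod_cast hn0
    rw [div_le_div_iff₀ (by positivity) (by positivity)]
    push_cast
    have : (0 : ℝ) ≤ N := by positivity
    nlinarith
  · exact le_liminf_of_le (isBoundedUnder_le_countLT P).isCoboundedUnder_ge
      (Eventually.of_forall fun n => by positivity)

/-- A property failing at all multiples of `p ≥ 1` has upper density less than one. -/
theorem limsup_countLT_lt_one {P : ℕ → Prop} {p : ℕ} (hp : 1 ≤ p)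
    (h : ∀ k, ¬ P (p * k)) :
    limsup (fun n : ℕ => ({i | i < n ∧ P i}.ncard : ℝ) / n) atTop < 1 := by
  have hp' : (0 : ℝ) < p := by exact_mod_cast hp
  refine lt_of_le_of_lt (b := 1 - 1 / (p : ℝ)) ?_ (by linarith [one_div_pos.2 hp'])
  refine limsup_le_of_le (isBoundedUnder_ge_countLT P).isCoboundedUnder_le ?_
  filter_upwards [eventually_gt_atTop 0] with n hn
  have hn' : (0 : ℝ) < n := by exact_mod_cast hn
  set q := (n + p - 1) / p with hq
  have hnq : n ≤ p * q := by
    have h1 := Nat.div_add_mod (n + p - 1) p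
    have h2 := Nat.mod_lt (n + p - 1) hp
    rw [← hq] at h1
    omega
  have hmem : ∀ k < q, p * k < n := by
    intro k hk
    have h1 : (k + 1) * p ≤ n + p - 1 := (Nat.le_div_iff_mul_le hp).1 hk
    rw [Nat.add_mul, one_mul, mul_comm k p] at h1
    omega
  have hcard : {i | i < n ∧ P i}.ncard + q ≤ n := by
    have hinj : Function.Injective fun k => p * k :=
      fun a b hab => Nat.eq_of_mul_eq_mul_left hp hab
    have hfin1 : {i | i < n ∧ P i}.Finite := (Set.finite_Iio n).subset fun i hi => hi.1
    have hfin2 : ((fun k => p * k) '' Set.Iio q).Finite := (Set.finite_Iio q).image _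
    calc {i | i < n ∧ P i}.ncard + q
        = {i | i < n ∧ P i}.ncard + ((fun k => p * k) '' Set.Iio q).ncard := by
          rw [Set.ncard_image_of_injective _ hinj]; simp
      _ = ({i | i < n ∧ P i} ∪ (fun k => p * k) '' Set.Iio q).ncard := by
          refine (Set.ncard_union_eq ?_ hfin1 hfin2).symm
          rw [Set.disjoint_left]
          rintro _ hi ⟨k, -, rfl⟩
          exact h k hi.2
      _ ≤ (Set.Iio n).ncard := by
          refine Set.ncard_le_ncard ?_ (Set.finite_Iio n)
          rintro i (hi | ⟨k, hk, rfl⟩)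
          · exact hi.1
          · exact hmem k hk
      _ = n := by simp
  have hcard' : ({i | i < n ∧ P i}.ncard : ℝ) + q ≤ n := by exact_mod_cast hcard
  have hnq' : (n : ℝ) ≤ p * q := by exact_mod_cast hnq
  have hq' : (n : ℝ) / p ≤ q := by rw [div_le_iff₀ hp']; linarith
  rw [div_le_iff₀ hn', sub_mul, one_mul, one_div, inv_mul_eq_div]
  linarith

end Density

section Shift

variable {S I : Type*} {φ : I → I}

theorem genShift_iterate (i : ℕ) (x : I → S) (α : I) :
    (genShift φ)^[i] x α = x (φ^[i] α) := by
  induction i generalizing x with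
  | zero => rfl
  | succ i ih => rw [Function.iterate_succ_apply, ih, Function.iterate_succ_apply']; rfl

theorem continuous_genShift [TopologicalSpace S] : Continuous (genShift (X := S) φ) :=
  continuous_pi fun α => continuous_apply (φ α)

theorem iterate_injective_of_not_periodicPt (h : ∀ θ, ¬ PeriodicPt φ θ) (α : I) :
    Function.Injective fun i : ℕ => φ^[i] α := by
  intro i j hij
  by_contra hne
  wlog hlt : i < j generalizing i j
  · exact this hij.symm (Ne.symm hne) (lt_of_le_of_ne (not_lt.1 hlt) (Ne.symm hne))
  refine h (φ^[i] α) ⟨j - i, by omega, ?_⟩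
  rw [← Function.iterate_add_apply, Nat.sub_add_cancel hlt.le]
  exact hij.symm

/-- Without periodic points, the iterates of a finite set eventually leave any finite set. -/
theorem eventually_iterate_notMem (h : ∀ θ, ¬ PeriodicPt φ θ) (D F : Finset I) :
    ∀ᶠ i : ℕ in atTop, ∀ α ∈ D, φ^[i] α ∉ F := by
  rw [Filter.eventually_all_finset]
  intro α _
  have hfin : ((fun i : ℕ => φ^[i] α) ⁻¹' (F : Set I)).Finite :=
    F.finite_toSet.preimage (iterate_injective_of_not_periodicPt h α).injOn
  simpa [Nat.cofinite_eq_atTop] using hfin.compl_mem_cofinite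

/-- `x` coincides with `y` along `φ^i(D)` for all times `i` in arbitrarily long windows. -/
def AgreesOnLongWindows (φ : I → I) (D : Finset I) (x y : I → S) : Prop :=
  ∀ m : ℕ, ∃ n ≥ m, ∀ i, n ≤ i → i < m * n → ∀ α ∈ D, x (φ^[i] α) = y (φ^[i] α)

/-- A combinatorial form of distributional scrambling for generalized shifts: the points
coincide along every finite set, and differ along `θ`, on arbitrarily long windows of time. -/
def WindowScrambled (φ : I → I) (θ : I) (x y : I → S) : Prop :=
  (∀ D : Finset I, AgreesOnLongWindows φ D x y) ∧
    ∀ m : ℕ, ∃ n ≥ m, ∀ i, n ≤ i → i < m * n → x (φ^[i] θ) ≠ y (φ^[i] θ)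

theorem WindowScrambled.symm {θ : I} {x y : I → S} (h : WindowScrambled φ θ x y) :
    WindowScrambled φ θ y x := by
  refine ⟨fun D m => ?_, fun m => ?_⟩
  · obtain ⟨n, hn, hi⟩ := h.1 D m
    exact ⟨n, hn, fun i h1 h2 α hα => (hi i h1 h2 α hα).symm⟩
  · obtain ⟨n, hn, hi⟩ := h.2 m
    exact ⟨n, hn, fun i h1 h2 => (hi i h1 h2).symm⟩

theorem not_windowScrambled_self (θ : I) (x : I → S) : ¬ WindowScrambled φ θ x x := by
  intro h
  obtain ⟨n, hn, hi⟩ := h.2 2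
  exact hi n le_rfl (by omega) rfl

variable [TopologicalSpace S]

theorem exists_finset_forall_eq_mem {U : Set (I → S)} (hU : IsOpen U) {x : I → S}
    (hx : x ∈ U) : ∃ F : Finset I, ∀ y : I → S, (∀ α ∈ F, y α = x α) → y ∈ U := by
  obtain ⟨F, u, hu, hF⟩ := isOpen_pi_iff.1 hU x hx
  exact ⟨F, fun y hy => hF fun α hα => by rw [hy α hα]; exact (hu α hα).2⟩

variable [DiscreteTopology S]

theorem isOpen_setOf_apply_eq (α : I) (s : S) : IsOpen {x : I → S | x α = s} :=
  (isOpen_discrete {s}).preimage (continuous_apply (A := fun _ => S) α)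

theorem eventually_residual_agreesOnLongWindows (h : ∀ θ, ¬ PeriodicPt φ θ) (D : Finset I)
    (y : I → S) : ∀ᶠ x in residual (I → S), AgreesOnLongWindows φ D x y := by
  classical
  refine eventually_countable_forall.2 fun m => ?_
  refine residual_of_dense_open ?_ ?_
  · have : {x : I → S | ∃ n ≥ m, ∀ i, n ≤ i → i < m * n → ∀ α ∈ D,
        x (φ^[i] α) = y (φ^[i] α)} = ⋃ n ∈ Set.Ici m, ⋂ i ∈ Finset.Ico n (m * n),
          ⋂ α ∈ D, {x | x (φ^[i] α) = y (φ^[i] α)} := by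
      ext x; simp [and_imp]
    rw [this]
    refine isOpen_biUnion fun n _ => isOpen_biInter_finset fun i _ =>
      isOpen_biInter_finset fun α _ => isOpen_setOf_apply_eq _ _
  · rw [dense_iff_inter_open]
    rintro U hU ⟨x, hx⟩
    obtain ⟨F, hF⟩ := exists_finset_forall_eq_mem hU hx
    obtain ⟨N, hN⟩ := eventually_atTop.1 (eventually_iterate_notMem h D F)
    refine ⟨F.piecewise x y, hF _ fun α hα => by simp [hα], max N m, le_max_right _ _, ?_⟩
    intro i hi _ α hα
    exact Finset.piecewise_eq_of_notMem _ _ _ (hN i (le_trans (le_max_left _ _) hi) α hα)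

theorem eventually_residual_windowScrambled [Countable I] [Nontrivial S]
    (h : ∀ θ, ¬ PeriodicPt φ θ) (θ : I) (y : I → S) :
    ∀ᶠ x in residual (I → S), WindowScrambled φ θ x y := by
  choose g hg using fun s : S => exists_ne s
  filter_upwards [eventually_countable_forall.2 fun D =>
      eventually_residual_agreesOnLongWindows h D y,
    eventually_residual_agreesOnLongWindows h {θ} (g ∘ y)] with x hx hx'
  refine ⟨hx, fun m => ?_⟩
  obtain ⟨n, hn, hi⟩ := hx' m
  refine ⟨n, hn, fun i h1 h2 => ?_⟩
  rw [hi i h1 h2 θ (Finset.mem_singleton_self θ)]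
  exact hg _

theorem eventually_residual_transitivePoint [Countable I] [Countable S] [Nonempty S]
    (hφ : Function.Injective φ) (h : ∀ θ, ¬ PeriodicPt φ θ) :
    ∀ᶠ x in residual (I → S), TransitivePoint (genShift φ) x := by
  classical
  obtain ⟨B, hBc, hBe, hB⟩ := TopologicalSpace.exists_countable_basis (I → S)
  have : Countable B := hBc
  have key : ∀ b : B, ∀ᶠ x in residual (I → S), ∃ i : ℕ, (genShift φ)^[i] x ∈ (b : Set _) := by
    rintro ⟨b, hb⟩
    refine residual_of_dense_open ?_ ?_
    · have : {x : I → S | ∃ i : ℕ, (genShift φ)^[i] x ∈ b}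
          = ⋃ i : ℕ, (genShift φ)^[i] ⁻¹' b := by ext x; simp
      rw [this]
      exact isOpen_iUnion fun i => (hB.isOpen hb).preimage (continuous_genShift.iterate i)
    · rw [dense_iff_inter_open]
      rintro U hU ⟨x, hx⟩
      obtain ⟨p, hp⟩ : b.Nonempty := Set.nonempty_iff_ne_empty.2 fun h => hBe (h ▸ hb)
      obtain ⟨F, hF⟩ := exists_finset_forall_eq_mem hU hx
      obtain ⟨D, hD⟩ := exists_finset_forall_eq_mem (hB.isOpen hb) hp
      obtain ⟨i, hi⟩ := (eventually_iterate_notMem h D F).exists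
      refine ⟨F.piecewise x (Function.extend (φ^[i]) p x),
        hF _ fun α hα => by simp [hα], i, hD _ fun α hα => ?_⟩
      rw [genShift_iterate, Finset.piecewise_eq_of_notMem _ _ _ (hi α hα),
        (hφ.iterate i).extend_apply]
  filter_upwards [eventually_countable_forall.2 key] with x hx
  rw [TransitivePoint, hB.dense_iff]
  intro b hb _
  obtain ⟨i, hi⟩ := hx ⟨b, hb⟩
  exact ⟨_, hi, i, rfl⟩

/-- A generalized shift with a transitive point comes from an injective map. -/
theorem injective_of_transitivePoint [Nontrivial S] {x : I → S}
    (hx : TransitivePoint (genShift φ) x) : Function.Injective φ := by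
  classical
  intro a b hab
  by_contra hne
  obtain ⟨p, q, hpq⟩ := exists_pair_ne S
  have key : ∀ p q : S, p ≠ q → x a = p ∧ x b = q := by
    intro p q hpq
    have hU : IsOpen {y : I → S | y a = p ∧ y b = q} :=
      (isOpen_setOf_apply_eq a p).inter (isOpen_setOf_apply_eq b q)
    obtain ⟨_, hy, i, rfl⟩ := hx.inter_open_nonempty _ hU
      ⟨fun α => if α = a then p else q, by simp, by simp [Ne.symm hne]⟩
    cases i with
    | zero => exact hy
    | succ i =>
      refine absurd (hy.1.symm.trans (Eq.trans ?_ hy.2)) hpq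
      simp only [genShift_iterate, Function.iterate_succ_apply, hab]
  exact hpq ((key p q hpq).1.symm.trans (key q p hpq.symm).1)

end Shift

section Conjugate

variable {S I Y : Type*} [TopologicalSpace S] [TopologicalSpace Y] {f : Y → Y} {φ : I → I}

theorem conj_iterate_apply {e : Y ≃ₜ (I → S)} (hf : ∀ y, e (f y) = genShift φ (e y)) (i : ℕ)
    (y : Y) (α : I) : e (f^[i] y) α = e y (φ^[i] α) := by
  rw [Function.Semiconj.iterate_right hf i y, genShift_iterate]

theorem TransitivePoint.of_conj {e : Y ≃ₜ (I → S)} (hf : ∀ y, e (f y) = genShift φ (e y))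
    {y : Y} (h : TransitivePoint (genShift φ) (e y)) : TransitivePoint f y := by
  have := h.preimage e.isOpenMap
  refine this.mono ?_
  rintro z ⟨n, hn⟩
  refine ⟨n, e.injective ?_⟩
  rw [Function.Semiconj.iterate_right hf n y]
  exact hn

theorem TransitivePoint.conj {e : Y ≃ₜ (I → S)} (hf : ∀ y, e (f y) = genShift φ (e y))
    {y : Y} (h : TransitivePoint f y) : TransitivePoint (genShift φ) (e y) := by
  have := e.surjective.denseRange.dense_image e.continuous h
  refine this.mono ?_
  rintro _ ⟨_, ⟨n, rfl⟩, rfl⟩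
  exact ⟨n, (Function.Semiconj.iterate_right hf n y).symm⟩

theorem WindowScrambled.Fdist_eq_zero {d : Y → Y → ℝ}
    {e : Y ≃ₜ (I → S)} (hf : ∀ y, e (f y) = genShift φ (e y)) {θ : I} {x y : Y}
    (h : WindowScrambled φ θ (e x) (e y)) {ε : ℝ}
    (hε : ∀ u v, d u v < ε → e u θ = e v θ) : Fdist d f x y ε = 0 := by
  refine liminf_countLT_eq_zero fun m => ?_
  obtain ⟨n, hn, hi⟩ := h.2 m
  refine ⟨n, hn, fun i h1 h2 hlt => hi i h1 h2 ?_⟩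
  rw [← conj_iterate_apply hf, ← conj_iterate_apply hf]
  exact hε _ _ hlt

variable [DiscreteTopology S] [Finite S]

theorem IsCompatibleMetric.exists_forall_eq {d : Y → Y → ℝ} (hd : IsCompatibleMetric Y d)
    (e : Y ≃ₜ (I → S)) (θ : I) : ∃ ε > 0, ∀ u v, d u v < ε → e u θ = e v θ := by
  have : CompactSpace Y := e.symm.compactSpace
  obtain ⟨m, rfl, hd⟩ := hd
  have hc : Continuous fun u => e u θ := (continuous_apply θ).comp e.continuous
  have hopen : IsOpen {p : Y × Y | e p.1 θ = e p.2 θ} :=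
    (isOpen_discrete {p : S × S | p.1 = p.2}).preimage (hc.prodMap hc)
  have hmem : {p : Y × Y | e p.1 θ = e p.2 θ} ∈ uniformity Y := by
    rw [← nhdsSet_diagonal_eq_uniformity, hopen.mem_nhdsSet]
    rintro ⟨u, v⟩ (rfl : u = v)
    rfl
  obtain ⟨ε, hε, h⟩ := Metric.mem_uniformity_dist.1 hmem
  exact ⟨ε, hε, fun u v huv => h (by rw [← hd] at huv; exact huv)⟩

theorem IsCompatibleMetric.exists_finset_forall_lt {d : Y → Y → ℝ}
    (hd : IsCompatibleMetric Y d) (e : Y ≃ₜ (I → S)) {s : ℝ} (hs : 0 < s) :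
    ∃ D : Finset I, ∀ u v, (∀ α ∈ D, e u α = e v α) → d u v < s := by
  classical
  have : CompactSpace Y := e.symm.compactSpace
  obtain ⟨m, rfl, hd⟩ := hd
  let V : Finset I → Set (Y × Y) := fun D => ⋂ α ∈ D, {p | e p.1 α = e p.2 α}
  have hclosed : ∀ D, IsClosed (V D) := fun D => isClosed_biInter fun α _ =>
    isClosed_eq ((continuous_apply α).comp (e.continuous.comp continuous_fst))
      ((continuous_apply α).comp (e.continuous.comp continuous_snd))
  have hanti : Antitone V := fun D E hDE => Set.biInter_subset_biInter_left hDE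
  obtain ⟨D, hD⟩ := exists_subset_nhds_of_isCompact' (V := V) hanti.directed_ge
    (fun D => (hclosed D).isCompact) hclosed (U := {p | dist p.1 p.2 < s}) (by
      rintro ⟨u, v⟩ h
      refine (isOpen_lt continuous_dist continuous_const).mem_nhds ?_
      have huv : u = v := by
        refine e.injective (funext fun α => ?_)
        have := Set.mem_iInter.1 h {α}
        simpa [V] using this
      simpa [huv] using hs)
  refine ⟨D, fun u v huv => ?_⟩
  rw [← hd]
  exact hD (show (u, v) ∈ V D by simpa [V] using huv)

theorem WindowScrambled.FdistStar_eq_one {d : Y → Y → ℝ} (hd : IsCompatibleMetric Y d)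
    {e : Y ≃ₜ (I → S)} (hf : ∀ y, e (f y) = genShift φ (e y)) {θ : I} {x y : Y}
    (h : WindowScrambled φ θ (e x) (e y)) {s : ℝ} (hs : 0 < s) : FdistStar d f x y s = 1 := by
  obtain ⟨D, hD⟩ := hd.exists_finset_forall_lt e hs
  refine limsup_countLT_eq_one fun m => ?_
  obtain ⟨n, hn, hi⟩ := h.1 D m
  refine ⟨n, hn, fun i h1 h2 => hD _ _ fun α hα => ?_⟩
  rw [conj_iterate_apply hf, conj_iterate_apply hf]
  exact hi i h1 h2 α hα

theorem exists_uniform_scrambled_subset [Countable I] [Nonempty I] [Nontrivial S]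
    {d : Y → Y → ℝ} (hd : IsCompatibleMetric Y d) {e : Y ≃ₜ (I → S)}
    (hf : ∀ y, e (f y) = genShift φ (e y)) (h : ∀ θ, ¬ PeriodicPt φ θ)
    {T : Set (I → S)} (hT : T ∈ residual (I → S)) :
    ∃ A : Set Y, ¬ A.Countable ∧ Dense A ∧ (∀ a ∈ A, e a ∈ T) ∧ DistScrambledSet1 d f A ∧
      ∃ ε > 0, ∀ x ∈ A, ∀ y ∈ A, x ≠ y → Fdist d f x y ε = 0 := by
  obtain ⟨θ⟩ := ‹Nonempty I›
  obtain ⟨A, hAc, hAd, hAT, hA⟩ := exists_uncountable_dense_pairwise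
    (R := WindowScrambled (S := S) φ θ) (fun _ _ => WindowScrambled.symm)
    (not_windowScrambled_self θ) (eventually_residual_windowScrambled h θ) hT
  obtain ⟨ε, hε, hεe⟩ := hd.exists_forall_eq e θ
  have hc : ¬ (e ⁻¹' A).Countable := fun hc => hAc <| by
    rw [← Set.image_preimage_eq A e.surjective]
    exact hc.image e
  have hF : ∀ x ∈ e ⁻¹' A, ∀ y ∈ e ⁻¹' A, x ≠ y → Fdist d f x y ε = 0 := fun x hx y hy hxy =>
    (hA _ hx _ hy (e.injective.ne hxy)).Fdist_eq_zero hf hεe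
  refine ⟨e ⁻¹' A, hc, hAd.preimage e.isOpenMap, fun a ha => hAT ha, ⟨?_, ?_⟩, ε, hε, hF⟩
  · rw [← Set.not_subsingleton_iff]
    exact fun hs => hc hs.countable
  · exact fun x hx y hy hxy => ⟨⟨ε, hε, hF x hx y hy hxy⟩, fun s hs =>
      (hA _ hx _ hy (e.injective.ne hxy)).FdistStar_eq_one hd hf hs⟩

/-- A system conjugate to a generalized shift `σ_φ` is dense distributionally chaotic iff `φ` has
no periodic points. -/
theorem denseDC_iff_of_conj [Countable I] [Nonempty I] [Nontrivial S]
    {d : Y → Y → ℝ} (hd : IsCompatibleMetric Y d) (e : Y ≃ₜ (I → S))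
    (hf : ∀ y, e (f y) = genShift φ (e y)) :
    DenseDC d f ↔ ∀ θ, ¬ PeriodicPt φ θ := by
  constructor
  · rintro ⟨A, -, hAd, ⟨-, hA⟩, -⟩ θ ⟨n, hn, hθ⟩
    obtain ⟨p, q, hpq⟩ := exists_pair_ne S
    have key : ∀ p : S, ∃ x ∈ A, e x θ = p := by
      intro p
      have hU : IsOpen {x : Y | e x θ = p} :=
        (isOpen_setOf_apply_eq θ p).preimage e.continuous
      obtain ⟨x, hx, hxA⟩ := hAd.inter_open_nonempty _ hU ⟨e.symm fun _ => p, by simp⟩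
      exact ⟨x, hxA, hx⟩
    obtain ⟨x, hx, hxp⟩ := key p
    obtain ⟨y, hy, hyq⟩ := key q
    have hxy : x ≠ y := by
      rintro rfl
      exact hpq (hxp.symm.trans hyq)
    obtain ⟨ε, hε, hεe⟩ := hd.exists_forall_eq e θ
    refine (limsup_countLT_lt_one hn ?_).ne ((hA x hx y hy hxy).2 ε hε)
    intro k hlt
    have hfix : φ^[n * k] θ = θ := by
      rw [Function.iterate_mul]
      exact Function.iterate_fixed hθ k
    have := hεe _ _ hlt
    rw [conj_iterate_apply hf, conj_iterate_apply hf, hfix, hxp, hyq] at this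
    exact hpq this
  · intro h
    obtain ⟨A, h1, h2, -, h3⟩ := exists_uniform_scrambled_subset hd hf h univ_mem
    exact ⟨A, h1, h2, h3⟩

/-- A system conjugate to a generalized shift `σ_φ` is transitive distributionally chaotic iff `φ`
is injective without periodic points. -/
theorem transitiveDC_iff_of_conj [Countable I] [Nonempty I] [Nontrivial S]
    {d : Y → Y → ℝ} (hd : IsCompatibleMetric Y d) (e : Y ≃ₜ (I → S))
    (hf : ∀ y, e (f y) = genShift φ (e y)) :
    TransitiveDC d f ↔ Function.Injective φ ∧ ∀ θ, ¬ PeriodicPt φ θ := by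
  constructor
  · rintro ⟨A, h1, h2, h3, h4⟩
    obtain ⟨a, ha, -⟩ := h4.1.1
    exact ⟨injective_of_transitivePoint ((h3 a ha).conj hf),
      (denseDC_iff_of_conj hd e hf).1 ⟨A, h1, h2, h4⟩⟩
  · rintro ⟨hφ, h⟩
    obtain ⟨A, h1, h2, h3, h4⟩ := exists_uniform_scrambled_subset hd hf h
      (eventually_residual_transitivePoint (S := S) hφ h)
    exact ⟨A, h1, h2, fun a ha => TransitivePoint.of_conj hf (h3 a ha), h4⟩

end Conjugate

theorem forall_not_periodicPt_sumMap_iff {I J : Type*} (φ : I → I) (ψ : J → J) :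
    (∀ θ, ¬ PeriodicPt (Sum.map φ ψ) θ) ↔
      (∀ θ, ¬ PeriodicPt φ θ) ∧ ∀ θ, ¬ PeriodicPt ψ θ := by
  have hl : ∀ θ, PeriodicPt (Sum.map φ ψ) (Sum.inl θ) ↔ PeriodicPt φ θ := fun θ => by
    have hit : ∀ n, (Sum.map φ ψ)^[n] (Sum.inl θ) = Sum.inl (φ^[n] θ) := fun n =>
      ((Function.Semiconj.iterate_right (f := Sum.inl) (fun _ => rfl) n) θ).symm
    simp [PeriodicPt, hit]
  have hr : ∀ θ, PeriodicPt (Sum.map φ ψ) (Sum.inr θ) ↔ PeriodicPt ψ θ := fun θ => by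
    have hit : ∀ n, (Sum.map φ ψ)^[n] (Sum.inr θ) = Sum.inr (ψ^[n] θ) := fun n =>
      ((Function.Semiconj.iterate_right (f := Sum.inr) (fun _ => rfl) n) θ).symm
    simp [PeriodicPt, hit]
  simp only [Sum.forall, hl, hr]

/-- for nonempty countable `Λ, Υ` and maps `λ, μ` (each distributional chaos
property taken with respect to any compatible metric): the product system
`(X^Λ × X^Υ, σ_λ × σ_μ)` is dense (resp. transitive) distributionally chaotic iff both
`(X^Λ, σ_λ)` and `(X^Υ, σ_μ)` are dense (resp. transitive) distributionally chaotic. -/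
theorem prod_denseDC_and_transitiveDC_iff
    {Λ Υ : Type*} [Countable Λ] [Nonempty Λ] [Countable Υ] [Nonempty Υ]
    (lam : Λ → Λ) (mu : Υ → Υ)
    (dP : ((Λ → X) × (Υ → X)) → ((Λ → X) × (Υ → X)) → ℝ)
    (hdP : IsCompatibleMetric ((Λ → X) × (Υ → X)) dP)
    (d₁ : (Λ → X) → (Λ → X) → ℝ) (hd₁ : IsCompatibleMetric (Λ → X) d₁)
    (d₂ : (Υ → X) → (Υ → X) → ℝ) (hd₂ : IsCompatibleMetric (Υ → X) d₂) :
    (DenseDC dP (Prod.map (genShift (X := X) lam) (genShift (X := X) mu)) ↔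
        (DenseDC d₁ (genShift (X := X) lam) ∧ DenseDC d₂ (genShift (X := X) mu))) ∧
    (TransitiveDC dP (Prod.map (genShift (X := X) lam) (genShift (X := X) mu)) ↔
        (TransitiveDC d₁ (genShift (X := X) lam) ∧
          TransitiveDC d₂ (genShift (X := X) mu))) := by
  have hP : ∀ z : (Λ → X) × (Υ → X), Homeomorph.sumArrowHomeomorphProdArrow.symm
      (Prod.map (genShift (X := X) lam) (genShift (X := X) mu) z) =
        genShift (Sum.map lam mu) (Homeomorph.sumArrowHomeomorphProdArrow.symm z) := by
    intro z
    funext α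
    cases α <;> rfl
  rw [denseDC_iff_of_conj hdP _ hP, transitiveDC_iff_of_conj hdP _ hP,
    denseDC_iff_of_conj (f := genShift lam) hd₁ (.refl _) fun _ => rfl,
    denseDC_iff_of_conj (f := genShift mu) hd₂ (.refl _) fun _ => rfl,
    transitiveDC_iff_of_conj (f := genShift lam) hd₁ (.refl _) fun _ => rfl,
    transitiveDC_iff_of_conj (f := genShift mu) hd₂ (.refl _) fun _ => rfl,
    forall_not_periodicPt_sumMap_iff, Sum.map_injective]
  tauto
end

section
/- Define λ, μ : ℤ → ℤ by λ(n) = n+1 if n is even and λ(n) = n−1 if n is odd, and μ(n) = n+1 if n is odd and μ(n) = n−1 if n is even. Then neither (X^ℤ, σ_λ) nor (X^ℤ, σ_μ) is uniform distributional chaotic, but both (X^ℤ, σ_μ ∘ σ_λ) and (X^ℤ, σ_λ ∘ σ_μ) are transitive distributional chaotic (with respect to any compatible metric on X^ℤ). -/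
open Filter Topology

variable {X : Type*} [Fintype X] [TopologicalSpace X] [DiscreteTopology X] [Nontrivial X]
variable {Γ : Type*} [Countable Γ] [Nonempty Γ]
/-! ### Compatible metrics -/

theorem IsCompatibleMetric.continuous {Y : Type*} [t : TopologicalSpace Y] {d : Y → Y → ℝ}
    (hd : IsCompatibleMetric Y d) : Continuous fun p : Y × Y => d p.1 p.2 := by
  obtain ⟨m, rfl, hm⟩ := hd
  simp only [← hm]
  exact continuous_dist

theorem IsCompatibleMetric.self {Y : Type*} [t : TopologicalSpace Y] {d : Y → Y → ℝ}
    (hd : IsCompatibleMetric Y d) (x : Y) : d x x = 0 := by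
  obtain ⟨m, rfl, hm⟩ := hd
  rw [← hm]
  exact dist_self x

theorem IsCompatibleMetric.pos {Y : Type*} [t : TopologicalSpace Y] {d : Y → Y → ℝ}
    (hd : IsCompatibleMetric Y d) {x y : Y} (h : x ≠ y) : 0 < d x y := by
  obtain ⟨m, rfl, hm⟩ := hd
  rw [← hm]
  exact dist_pos.2 h

/-- Points agreeing on a large enough window of coordinates are uniformly close. -/
theorem IsCompatibleMetric.exists_window {X Γ : Type*} [TopologicalSpace X] [T2Space X]
    [CompactSpace X] {d : (Γ → X) → (Γ → X) → ℝ} (hd : IsCompatibleMetric (Γ → X) d)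
    (pos : Γ → ℤ) {t : ℝ} (ht : 0 < t) :
    ∃ r : ℕ, ∀ x y : Γ → X, (∀ γ, (pos γ).natAbs ≤ r → x γ = y γ) → d x y < t := by
  by_contra! hcon
  let K : ℕ → Set ((Γ → X) × (Γ → X)) := fun r =>
    {p | (∀ γ, (pos γ).natAbs ≤ r → p.1 γ = p.2 γ) ∧ t ≤ d p.1 p.2}
  have hclosed : ∀ r, IsClosed (K r) := by
    intro r
    refine IsClosed.inter ?_ (isClosed_le continuous_const hd.continuous)
    have : {p : (Γ → X) × (Γ → X) | ∀ γ, (pos γ).natAbs ≤ r → p.1 γ = p.2 γ} =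
        ⋂ γ, ⋂ (_ : (pos γ).natAbs ≤ r), {p | p.1 γ = p.2 γ} := by
      ext; simp
    change IsClosed {p : (Γ → X) × (Γ → X) | ∀ γ, (pos γ).natAbs ≤ r → p.1 γ = p.2 γ}
    rw [this]
    exact isClosed_iInter fun γ => isClosed_iInter fun _ =>
      isClosed_eq (by fun_prop) (by fun_prop)
  obtain ⟨p, hp⟩ := IsCompact.nonempty_iInter_of_sequence_nonempty_isCompact_isClosed K
    (fun r p hp => ⟨fun γ hγ => hp.1 γ (by omega), hp.2⟩)
    (fun r => by
      obtain ⟨x, y, h1, h2⟩ := hcon r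
      exact ⟨(x, y), h1, h2⟩)
    (hclosed 0).isCompact hclosed
  rw [Set.mem_iInter] at hp
  have heq : p.1 = p.2 := funext fun γ => (hp (pos γ).natAbs).1 γ le_rfl
  have h2 := (hp 0).2
  rw [heq, hd.self] at h2
  linarith

/-- Points that differ at a given coordinate are uniformly separated. -/
theorem IsCompatibleMetric.exists_separation {X Γ : Type*} [TopologicalSpace X]
    [DiscreteTopology X] [CompactSpace X] {d : (Γ → X) → (Γ → X) → ℝ}
    (hd : IsCompatibleMetric (Γ → X) d) (γ : Γ) :
    ∃ ε > 0, ∀ x y : Γ → X, x γ ≠ y γ → ε ≤ d x y := by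
  let K : Set ((Γ → X) × (Γ → X)) := {p | p.1 γ ≠ p.2 γ}
  have hK : IsClosed K := by
    have : K = (fun p : (Γ → X) × (Γ → X) => (p.1 γ, p.2 γ)) ⁻¹' {q | q.1 ≠ q.2} := rfl
    rw [this]
    exact (isClosed_discrete _).preimage (by fun_prop)
  rcases K.eq_empty_or_nonempty with h | h
  · refine ⟨1, one_pos, fun x y hxy => ?_⟩
    have : (x, y) ∈ K := hxy
    simp [h] at this
  · obtain ⟨p, hp, hmin⟩ := hK.isCompact.exists_isMinOn h hd.continuous.continuousOn
    exact ⟨d p.1 p.2, hd.pos fun e => hp (congrFun e γ), fun x y hxy =>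
      hmin (show (x, y) ∈ K from hxy)⟩

/-! ### Counting close times -/

section Counting

variable {Y : Type*} {d : Y → Y → ℝ} {f : Y → Y} {x y : Y} {t : ℝ}

theorem xiCount_le_of_far {a n : ℕ} (h : ∀ i, a ≤ i → i < n → t ≤ d (f^[i] x) (f^[i] y)) :
    xiCount d f x y t n ≤ a := by
  have hsub : {i : ℕ | i < n ∧ d (f^[i] x) (f^[i] y) < t} ⊆ Set.Iio a := by
    rintro i ⟨hi, hlt⟩
    by_contra hia
    exact absurd hlt (not_lt.2 (h i (not_lt.1 hia) hi))
  simpa [xiCount] using Set.ncard_le_ncard hsub (Set.finite_Iio a)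

theorem xiCount_le (d : Y → Y → ℝ) (f : Y → Y) (x y : Y) (t : ℝ) (n : ℕ) :
    xiCount d f x y t n ≤ n :=
  xiCount_le_of_far fun _ h h' => absurd h' (not_lt.2 h)

theorem sub_le_xiCount {b c n : ℕ} (hcn : c ≤ n)
    (h : ∀ i, b ≤ i → i < c → d (f^[i] x) (f^[i] y) < t) : c - b ≤ xiCount d f x y t n := by
  have hsub : Set.Ico b c ⊆ {i : ℕ | i < n ∧ d (f^[i] x) (f^[i] y) < t} :=
    fun i hi => ⟨hi.2.trans_le hcn, h i hi.1 hi.2⟩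
  have hfin : {i : ℕ | i < n ∧ d (f^[i] x) (f^[i] y) < t}.Finite :=
    (Set.finite_Iio n).subset fun i hi => hi.1
  have := Set.ncard_le_ncard hsub hfin
  rwa [← Finset.coe_Ico, Set.ncard_coe_finset, Nat.card_Ico] at this

theorem xiCount_div_nonneg (n : ℕ) : 0 ≤ (xiCount d f x y t n : ℝ) / n := by positivity

theorem xiCount_div_le_one (n : ℕ) : (xiCount d f x y t n : ℝ) / n ≤ 1 :=
  div_le_one_of_le₀ (by exact_mod_cast xiCount_le d f x y t n) (by positivity)

theorem isBoundedUnder_le_xiCount_div :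
    IsBoundedUnder (· ≤ ·) atTop fun n : ℕ => (xiCount d f x y t n : ℝ) / n :=
  isBoundedUnder_of ⟨1, xiCount_div_le_one⟩

theorem isBoundedUnder_ge_xiCount_div :
    IsBoundedUnder (· ≥ ·) atTop fun n : ℕ => (xiCount d f x y t n : ℝ) / n :=
  isBoundedUnder_of ⟨0, xiCount_div_nonneg⟩

theorem Fdist_eq_zero
    (h : ∀ δ > 0, ∃ᶠ n : ℕ in atTop, (xiCount d f x y t n : ℝ) / n ≤ δ) :
    Fdist d f x y t = 0 := by
  refine le_antisymm (le_of_forall_pos_le_add fun δ hδ => ?_) ?_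
  · rw [zero_add]
    exact liminf_le_of_frequently_le (h δ hδ) isBoundedUnder_ge_xiCount_div
  · exact le_liminf_of_le isBoundedUnder_le_xiCount_div.isCoboundedUnder_ge
      (Eventually.of_forall xiCount_div_nonneg)

theorem FdistStar_eq_one
    (h : ∀ δ > 0, ∃ᶠ n : ℕ in atTop, 1 - δ ≤ (xiCount d f x y t n : ℝ) / n) :
    FdistStar d f x y t = 1 := by
  refine le_antisymm ?_ (le_of_forall_sub_le fun δ hδ => ?_)
  · exact limsup_le_of_le isBoundedUnder_ge_xiCount_div.isCoboundedUnder_le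
      (Eventually.of_forall xiCount_div_le_one)
  · exact le_limsup_of_frequently_le (h δ hδ) isBoundedUnder_le_xiCount_div

end Counting

/-! ### Involutions are not chaotic -/

theorem Function.Involutive.not_uniformDC {Y : Type*} [TopologicalSpace Y] {d : Y → Y → ℝ}
    (hd : IsCompatibleMetric Y d) {f : Y → Y} (hf : Function.Involutive f) :
    ¬ UniformDC d f := by
  rintro ⟨A, -, ⟨⟨x, hx, y, hy, hxy⟩, hA⟩, -⟩
  have hstar := (hA x hx y hy hxy).2 (min (d x y) (d (f x) (f y)))
    (lt_min (hd.pos hxy) (hd.pos (hf.injective.ne hxy)))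
  have hzero : ∀ n, xiCount d f x y (min (d x y) (d (f x) (f y))) n = 0 := by
    intro n
    refine Nat.le_zero.1 (xiCount_le_of_far fun i _ _ => ?_)
    rcases Nat.even_or_odd i with hi | hi
    · simp [hf.iterate_even hi]
    · simp [hf.iterate_odd hi]
  simp [FdistStar, hzero] at hstar

/-! ### Chaos of shifts along infinite orbits -/

/-- The index `j` of the block `[(j + 1)!, (j + 2)!)` containing `k`. -/
def factorialBlock (k : ℕ) : ℕ := Nat.findGreatest (fun j => (j + 1).factorial ≤ k) k

theorem factorialBlock_eq {j k : ℕ} (h1 : (j + 1).factorial ≤ k)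
    (h2 : k < (j + 2).factorial) : factorialBlock k = j := by
  refine Nat.findGreatest_eq_iff.2 ⟨?_, fun _ => h1, fun n hn _ h => ?_⟩
  · have := Nat.self_le_factorial (j + 1)
    omega
  · have : (j + 2).factorial ≤ (n + 1).factorial := Nat.factorial_le (by omega)
    omega

section Scrambled

variable {X Γ : Type*} (h : Equiv.Perm Γ) (pos : Γ → ℤ) (D : ℕ → Γ → X) (p q : X)
  (κ : (ℕ → Bool) → ℕ)

/-- A family of points of `Γ → X` indexed by `s : ℕ → Bool`. Near the origin the point indexed by
`s` copies a member of `D` chosen by `κ s`. Further out, blocks of even index carry a translate of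
a member of `D` and do not depend on `s`, while blocks of odd index carry a constant encoding one
digit of `s`. -/
def scrambledPoint (s : ℕ → Bool) (γ : Γ) : X :=
  if (pos γ).natAbs ≤ κ s then D (κ s).unpair.1 γ
  else
    let j := factorialBlock (pos γ).toNat
    if Even j then D (j / 2).unpair.1 ((h ^ ((j + 1).factorial + j / 2)).symm γ)
    else if s (j / 2).unpair.1 then p else q

variable {h pos D p q κ}

theorem scrambledPoint_center {s : ℕ → Bool} {γ : Γ} (hγ : (pos γ).natAbs ≤ κ s) :
    scrambledPoint h pos D p q κ s γ = D (κ s).unpair.1 γ := by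
  simp [scrambledPoint, hγ]

theorem scrambledPoint_even {s : ℕ → Bool} {γ : Γ} {m : ℕ} (hs : κ s < (2 * m + 1).factorial)
    (h1 : ((2 * m + 1).factorial : ℤ) ≤ pos γ) (h2 : pos γ < (2 * m + 2).factorial) :
    scrambledPoint h pos D p q κ s γ =
      D m.unpair.1 ((h ^ ((2 * m + 1).factorial + m)).symm γ) := by
  have hb : factorialBlock (pos γ).toNat = 2 * m := factorialBlock_eq (by omega) (by omega)
  have hn : ¬ (pos γ).natAbs ≤ κ s := by omega
  simp [scrambledPoint, hb, hn]

theorem scrambledPoint_odd {s : ℕ → Bool} {γ : Γ} {m : ℕ} (hs : κ s < (2 * m + 2).factorial)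
    (h1 : ((2 * m + 2).factorial : ℤ) ≤ pos γ) (h2 : pos γ < (2 * m + 3).factorial) :
    scrambledPoint h pos D p q κ s γ = if s m.unpair.1 then p else q := by
  have hb : factorialBlock (pos γ).toNat = 2 * m + 1 :=
    factorialBlock_eq (j := 2 * m + 1) (show (2 * m + 2).factorial ≤ _ by omega)
      (show _ < (2 * m + 3).factorial by omega)
  have hn : ¬ (pos γ).natAbs ≤ κ s := by omega
  have hm : (2 * m + 1) / 2 = m := by omega
  simp [scrambledPoint, hb, hn, hm]

theorem genShift_iterate_s19 (φ : Γ → Γ) (n : ℕ) (x : Γ → X) (γ : Γ) :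
    (genShift φ)^[n] x γ = x (φ^[n] γ) := by
  induction n generalizing x with
  | zero => rfl
  | succ n ih => rw [Function.iterate_succ_apply, ih, Function.iterate_succ_apply', genShift]

theorem pos_iterate (hpos : ∀ γ, pos (h γ) = pos γ + 1) (n : ℕ) (γ : Γ) :
    pos (h^[n] γ) = pos γ + n := by
  induction n with
  | zero => simp
  | succ n ih => rw [Function.iterate_succ_apply', hpos, ih]; push_cast; ring

theorem genShift_scrambledPoint_window (hpos : ∀ γ, pos (h γ) = pos γ + 1) {s : ℕ → Bool}
    {m : ℕ} (hs : κ s < (2 * m + 1).factorial) {γ : Γ} (hγ : (pos γ).natAbs ≤ m) :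
    (genShift h)^[(2 * m + 1).factorial + m] (scrambledPoint h pos D p q κ s) γ =
      D m.unpair.1 γ := by
  have hfac : (2 * m + 2).factorial = (2 * m + 2) * (2 * m + 1).factorial :=
    Nat.factorial_succ _
  have hone := Nat.self_le_factorial (2 * m + 1)
  have hlt : 2 * m + (2 * m + 1).factorial < (2 * m + 2).factorial := by
    rw [hfac]; nlinarith
  have hit := pos_iterate hpos ((2 * m + 1).factorial + m) γ
  rw [genShift_iterate_s19, scrambledPoint_even (m := m) hs, Equiv.Perm.iterate_eq_pow,
    Equiv.symm_apply_apply]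
  · rw [hit]; push_cast; omega
  · rw [hit]; push_cast; omega

theorem genShift_scrambledPoint_ne (hpos : ∀ γ, pos (h γ) = pos γ + 1) (hpq : p ≠ q)
    {s s' : ℕ → Bool} {m : ℕ} (hs : κ s < (2 * m + 2).factorial)
    (hs' : κ s' < (2 * m + 2).factorial) (hne : s m.unpair.1 ≠ s' m.unpair.1)
    {γ : Γ} (hγ : pos γ = 0) {i : ℕ} (h1 : (2 * m + 2).factorial ≤ i)
    (h2 : i < (2 * m + 3).factorial) :
    (genShift h)^[i] (scrambledPoint h pos D p q κ s) γ ≠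
      (genShift h)^[i] (scrambledPoint h pos D p q κ s') γ := by
  have hit := pos_iterate hpos i γ
  rw [genShift_iterate_s19, genShift_iterate_s19, scrambledPoint_odd (m := m) hs (by omega) (by omega),
    scrambledPoint_odd (m := m) hs' (by omega) (by omega)]
  cases hb : s m.unpair.1 <;> cases hb' : s' m.unpair.1 <;> simp_all [hpq.symm]

theorem genShift_scrambledPoint_eq (hpos : ∀ γ, pos (h γ) = pos γ + 1)
    {s s' : ℕ → Bool} {m r : ℕ} (hs : κ s < (2 * m + 1).factorial)
    (hs' : κ s' < (2 * m + 1).factorial) {γ : Γ} (hγ : (pos γ).natAbs ≤ r) {i : ℕ}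
    (h1 : (2 * m + 1).factorial + r ≤ i) (h2 : i < (2 * m + 2).factorial - r) :
    (genShift h)^[i] (scrambledPoint h pos D p q κ s) γ =
      (genShift h)^[i] (scrambledPoint h pos D p q κ s') γ := by
  have hit := pos_iterate hpos i γ
  rw [genShift_iterate_s19, genShift_iterate_s19, scrambledPoint_even (m := m) hs (by omega) (by omega),
    scrambledPoint_even (m := m) hs' (by omega) (by omega)]

theorem exists_large_digit_index (N i : ℕ) : ∃ m ≥ N, m.unpair.1 = i :=
  ⟨Nat.pair i N, Nat.right_le_pair i N, by simp⟩

theorem Fdist_scrambledPoint (hpos : ∀ γ, pos (h γ) = pos γ + 1) (hpq : p ≠ q)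
    {d : (Γ → X) → (Γ → X) → ℝ} {γ : Γ} (hγ : pos γ = 0) {ε : ℝ}
    (hε : ∀ x y : Γ → X, x γ ≠ y γ → ε ≤ d x y) {s s' : ℕ → Bool} (hss : s ≠ s') :
    Fdist d (genShift h) (scrambledPoint h pos D p q κ s) (scrambledPoint h pos D p q κ s') ε
      = 0 := by
  obtain ⟨k, hk⟩ := Function.ne_iff.1 hss
  refine Fdist_eq_zero fun δ hδ => frequently_atTop.2 fun N => ?_
  obtain ⟨M, hM⟩ := exists_nat_gt (1 / δ)
  obtain ⟨m, hm, hmk⟩ := exists_large_digit_index (N + M + κ s + κ s') k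
  have ha := Nat.self_le_factorial (2 * m + 2)
  have hb := Nat.self_le_factorial (2 * m + 3)
  refine ⟨(2 * m + 3).factorial, by omega, ?_⟩
  have hcount : xiCount d (genShift h) (scrambledPoint h pos D p q κ s)
      (scrambledPoint h pos D p q κ s') ε (2 * m + 3).factorial ≤ (2 * m + 2).factorial :=
    xiCount_le_of_far fun i hi1 hi2 => hε _ _
      (genShift_scrambledPoint_ne hpos hpq (by omega) (by omega) (by rwa [hmk]) hγ hi1 hi2)
  have hfac : ((2 * m + 3).factorial : ℝ) = (2 * m + 3) * (2 * m + 2).factorial := by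
    rw [Nat.factorial_succ (2 * m + 2)]; push_cast; ring
  have hMm : (M : ℝ) ≤ m := by exact_mod_cast (by omega : M ≤ m)
  have hδm : 1 ≤ δ * (2 * m + 3) := by
    rw [div_lt_iff₀ hδ] at hM
    nlinarith
  rw [div_le_iff₀ (by positivity), hfac]
  have hcount' : (xiCount d (genShift h) (scrambledPoint h pos D p q κ s)
      (scrambledPoint h pos D p q κ s') ε (2 * m + 3).factorial : ℝ) ≤ (2 * m + 2).factorial := by
    exact_mod_cast hcount
  nlinarith [(Nat.cast_nonneg (2 * m + 2).factorial : (0 : ℝ) ≤ _)]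

theorem FdistStar_scrambledPoint (hpos : ∀ γ, pos (h γ) = pos γ + 1)
    {d : (Γ → X) → (Γ → X) → ℝ} {t : ℝ} {r : ℕ}
    (hr : ∀ x y : Γ → X, (∀ γ, (pos γ).natAbs ≤ r → x γ = y γ) → d x y < t)
    (s s' : ℕ → Bool) :
    FdistStar d (genShift h) (scrambledPoint h pos D p q κ s) (scrambledPoint h pos D p q κ s') t
      = 1 := by
  refine FdistStar_eq_one fun δ hδ => frequently_atTop.2 fun N => ?_
  obtain ⟨M, hM⟩ := exists_nat_gt (1 / δ)
  obtain ⟨m, hm⟩ : ∃ m, m = N + M + κ s + κ s' + r := ⟨_, rfl⟩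
  have ha := Nat.self_le_factorial (2 * m + 1)
  have hb := Nat.self_le_factorial (2 * m + 2)
  refine ⟨(2 * m + 2).factorial, by omega, ?_⟩
  have hcount : (2 * m + 2).factorial - r - ((2 * m + 1).factorial + r) ≤
      xiCount d (genShift h) (scrambledPoint h pos D p q κ s)
        (scrambledPoint h pos D p q κ s') t (2 * m + 2).factorial :=
    sub_le_xiCount (by omega) fun i hi1 hi2 => hr _ _ fun γ hγ =>
      genShift_scrambledPoint_eq hpos (by omega) (by omega) hγ hi1 hi2
  have hcount' : ((2 * m + 2).factorial : ℝ) ≤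
      xiCount d (genShift h) (scrambledPoint h pos D p q κ s)
        (scrambledPoint h pos D p q κ s') t (2 * m + 2).factorial
        + 2 * (2 * m + 1).factorial := by
    exact_mod_cast (by omega)
  have hfac : ((2 * m + 2).factorial : ℝ) = (2 * m + 2) * (2 * m + 1).factorial := by
    rw [Nat.factorial_succ (2 * m + 1)]; push_cast; ring
  have hMm : (M : ℝ) ≤ m := by exact_mod_cast (by omega : M ≤ m)
  have hδm : 2 ≤ δ * (2 * m + 2) := by
    rw [div_lt_iff₀ hδ] at hM
    nlinarith
  rw [le_div_iff₀ (by positivity)]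
  nlinarith [(Nat.cast_nonneg (2 * m + 1).factorial : (0 : ℝ) ≤ _)]

end Scrambled

/-- Membership in a nonempty open set can be certified by agreeing with a member of a given dense
sequence on a window. -/
theorem exists_window_of_isOpen {X Γ : Type*} [TopologicalSpace X] {D : ℕ → Γ → X}
    (hD : DenseRange D) (pos : Γ → ℤ) {U : Set (Γ → X)} (hU : IsOpen U) (hne : U.Nonempty) :
    ∃ k r : ℕ, ∀ y : Γ → X, (∀ γ, (pos γ).natAbs ≤ r → y γ = D k γ) → y ∈ U := by
  obtain ⟨k, hk⟩ := hD.exists_mem_open hU hne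
  obtain ⟨I, u, hu, hIU⟩ := isOpen_pi_iff.1 hU _ hk
  refine ⟨k, I.sup fun γ => (pos γ).natAbs, fun y hy => hIU fun γ hγ => ?_⟩
  rw [hy γ (Finset.le_sup (f := fun γ => (pos γ).natAbs) hγ)]
  exact (hu γ hγ).2

/-- A shift along a permutation of a countable set that admits a height function increasing by
one is transitive distributionally chaotic. -/
theorem transitiveDC_genShift {X Γ : Type*} [Finite X] [TopologicalSpace X] [DiscreteTopology X]
    [Nontrivial X] [Countable Γ] {d : (Γ → X) → (Γ → X) → ℝ}
    (hd : IsCompatibleMetric (Γ → X) d) (h : Equiv.Perm Γ) (pos : Γ → ℤ)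
    (hpos : ∀ γ, pos (h γ) = pos γ + 1) {γ : Γ} (hγ : pos γ = 0) :
    TransitiveDC d (genShift (X := X) h) := by
  obtain ⟨p, q, hpq⟩ := exists_pair_ne X
  let D := TopologicalSpace.denseSeq (Γ → X)
  have hD : DenseRange D := TopologicalSpace.denseRange_denseSeq _
  obtain ⟨κ, hκ⟩ : ∃ κ : (ℕ → Bool) → ℕ, Function.Surjective κ :=
    ⟨_, Function.invFun_surjective (Infinite.natEmbedding (ℕ → Bool)).injective⟩
  let P := scrambledPoint h pos D p q κ
  obtain ⟨ε, hε0, hε⟩ := hd.exists_separation γ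
  have hF : ∀ {s s'}, s ≠ s' → Fdist d (genShift h) (P s) (P s') ε = 0 := fun hss =>
    Fdist_scrambledPoint hpos hpq hγ hε hss
  have hstar : ∀ s s', ∀ t > 0, FdistStar d (genShift h) (P s) (P s') t = 1 := by
    intro s s' t ht
    obtain ⟨r, hr⟩ := hd.exists_window pos ht
    exact FdistStar_scrambledPoint hpos hr s s'
  have hinj : Function.Injective P := by
    intro s s' hP
    by_contra hss
    obtain ⟨k, hk⟩ := Function.ne_iff.1 hss
    obtain ⟨m, hm, hmk⟩ := exists_large_digit_index (κ s + κ s') k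
    have ha := Nat.self_le_factorial (2 * m + 2)
    refine genShift_scrambledPoint_ne (D := D) (h := h) (κ := κ) hpos hpq (m := m) (s := s)
      (s' := s') (by omega) (by omega) (by rwa [hmk]) hγ le_rfl
      ((Nat.factorial_lt (by omega)).2 (by omega)) ?_
    exact congrArg (fun x => (genShift h)^[(2 * m + 2).factorial] x γ) hP
  refine ⟨Set.range P, ?_, ?_, ?_, ⟨?_, ?_⟩, ε, hε0, ?_⟩
  · intro hc
    rw [← Set.image_univ] at hc
    have : Countable (ℕ → Bool) := Set.countable_univ_iff.1
      (Set.countable_of_injective_of_countable_image hinj.injOn hc)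
    obtain ⟨e, he⟩ := exists_surjective_nat (ℕ → Bool)
    obtain ⟨n, hn⟩ := he fun n => !e n n
    simpa using congrFun hn n
  · refine dense_iff_inter_open.2 fun U hU hne => ?_
    obtain ⟨k, r, hkr⟩ := exists_window_of_isOpen hD pos hU hne
    obtain ⟨m, hm, hmk⟩ := exists_large_digit_index r k
    obtain ⟨s, rfl⟩ := hκ m
    refine ⟨P s, hkr _ fun γ' hγ' => ?_, s, rfl⟩
    rw [← hmk]
    exact scrambledPoint_center (hγ'.trans hm)
  · rintro _ ⟨s, rfl⟩
    refine dense_iff_inter_open.2 fun U hU hne => ?_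
    obtain ⟨k, r, hkr⟩ := exists_window_of_isOpen hD pos hU hne
    obtain ⟨m, hm, hmk⟩ := exists_large_digit_index (r + κ s) k
    have ha := Nat.self_le_factorial (2 * m + 1)
    refine ⟨_, hkr _ fun γ' hγ' => ?_, (2 * m + 1).factorial + m, rfl⟩
    rw [← hmk]
    exact genShift_scrambledPoint_window hpos (by omega) (by omega)
  · exact Set.nontrivial_of_exists_ne (Set.mem_range_self fun _ => true)
      ⟨_, Set.mem_range_self fun _ => false, hinj.ne fun e => by simpa using congrFun e 0⟩
  · rintro _ ⟨s, rfl⟩ _ ⟨s', rfl⟩ hne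
    exact ⟨⟨ε, hε0, hF fun e => hne (e ▸ rfl)⟩, hstar s s'⟩
  · rintro _ ⟨s, rfl⟩ _ ⟨s', rfl⟩ hne
    exact hF fun e => hne (e ▸ rfl)

theorem Function.Involutive.genShift {X Γ : Type*} {φ : Γ → Γ} (hφ : Function.Involutive φ) :
    Function.Involutive (genShift (X := X) φ) :=
  fun x => funext fun γ => congrArg x (hφ γ)

/-- for `λ(n) = n+1` if `n` even, `n-1` if `n` odd, and `μ(n) = n+1` if `n`
odd, `n-1` if `n` even: neither `(X^ℤ, σ_λ)` nor `(X^ℤ, σ_μ)` is uniform distributionally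
chaotic, but both `(X^ℤ, σ_μ ∘ σ_λ)` and `(X^ℤ, σ_λ ∘ σ_μ)` are transitive distributionally
chaotic (w.r.t. any compatible metric on `X^ℤ`). -/
theorem composition_counterexample
    (lam mu : ℤ → ℤ)
    (hlam : ∀ n : ℤ, lam n = if Even n then n + 1 else n - 1)
    (hmu : ∀ n : ℤ, mu n = if Even n then n - 1 else n + 1)
    (d : (ℤ → X) → (ℤ → X) → ℝ) (hd : IsCompatibleMetric (ℤ → X) d) :
    ¬ UniformDC d (genShift (X := X) lam) ∧
    ¬ UniformDC d (genShift (X := X) mu) ∧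
    TransitiveDC d (genShift (X := X) mu ∘ genShift (X := X) lam) ∧
    TransitiveDC d (genShift (X := X) lam ∘ genShift (X := X) mu) := by
  have hl : Function.Involutive lam := by
    intro n
    rw [hlam (lam n), hlam n]
    split_ifs <;> grind
  have hm : Function.Involutive mu := by
    intro n
    rw [hmu (mu n), hmu n]
    split_ifs <;> grind
  refine ⟨hl.genShift.not_uniformDC hd, hm.genShift.not_uniformDC hd, ?_, ?_⟩
  · refine transitiveDC_genShift hd (hm.toPerm.trans hl.toPerm)
      (fun n => if Even n then -(n / 2) else n / 2) (fun n => ?_) (γ := 0) (by simp)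
    simp only [Equiv.trans_apply, Function.Involutive.coe_toPerm, hlam, hmu]
    grind
  · refine transitiveDC_genShift hd (hl.toPerm.trans hm.toPerm)
      (fun n => if Even n then n / 2 else -(n / 2)) (fun n => ?_) (γ := 0) (by simp)
    simp only [Equiv.trans_apply, Function.Involutive.coe_toPerm, hlam, hmu]
    grind
end
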